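/- Let T be a stable balanced tree of the tree connection game with n agents of height h with degree sequence (0, 1, 2, 4, d_{h−4}, …, d_0), where d_i ≤ 2·d_{i+1} + 1 for every i ≤ h − 4, and assume n ≥ 3. Then the Fairness Ratio satisfies FR(T) ≤ 2.4318 · n · (ln ln(4·√(n/5)))² / (ln(4·√(n/5)))². -/

import Mathlib

open Function
open scoped ENNReal Classical

noncomputable section

namespace TCG

variable {n : ℕ}

/-- In-degree of node `v` in the network induced by profile `s` with root `r`:
the number of activated edges `(u, v)` with `u` an agent (a non-root node). -/
def indeg (r : Fin (n + 1)) (s : Fin (n + 1) → Fin (n + 1)) (v : Fin (n + 1)) : ℕ :=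
  Nat.card {u : Fin (n + 1) | u ≠ r ∧ s u = v}

/-- `|T(u)|`: the number of nodes having a directed path to `u` (including `u` itself). -/
def subtreeSize (s : Fin (n + 1) → Fin (n + 1)) (u : Fin (n + 1)) : ℕ :=
  Nat.card {w : Fin (n + 1) | ∃ k, s^[k] w = u}

/-- Cost of the agent at node `v` with respect to the root `r`:
the sum, over the edges `(u, u')` of the unique directed path from `v` to `r`,
of `indeg(u') / |T(u)|`; the cost is `∞` if no such path exists. -/
def cost (r : Fin (n + 1)) (s : Fin (n + 1) → Fin (n + 1)) (v : Fin (n + 1)) : ℝ≥0∞ :=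
  if h : ∃ k, s^[k] v = r then
    ∑ k ∈ Finset.range (Nat.find h),
      (indeg r s (s^[k + 1] v) : ℝ≥0∞) / (subtreeSize s (s^[k] v) : ℝ≥0∞)
  else ⊤

/-- A valid strategy profile: the root is absorbing (a formal convention encoding that the
root activates no edge), and every agent chooses a node different from herself. -/
def ValidProfile (r : Fin (n + 1)) (s : Fin (n + 1) → Fin (n + 1)) : Prop :=
  s r = r ∧ ∀ v, v ≠ r → s v ≠ v

/-- Pure Nash equilibrium (the induced network is *stable*): no agent can strictly
decrease her cost by unilaterally switching her activated edge to another node. -/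
def IsStable (r : Fin (n + 1)) (s : Fin (n + 1) → Fin (n + 1)) : Prop :=
  ValidProfile r s ∧
    ∀ v, v ≠ r → ∀ w, w ≠ v → cost r s v ≤ cost r (Function.update s v w) v

/-- Social cost: the sum of the costs of all agents (the non-root nodes). -/
def SC (s : Fin (n + 1) → Fin (n + 1)) : ℝ≥0∞ :=
  ∑ v ∈ Finset.univ.erase (0 : Fin (n + 1)), cost 0 s v

/-- Height of the induced network: the maximum length of a (leaf-to-)root path,
i.e. the least `k` such that every node arrives at the root after `k` steps. -/
def height (s : Fin (n + 1) → Fin (n + 1)) : ℕ :=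
  sInf {k | ∀ v, s^[k] v = 0}

/-- Fairness Ratio: maximum agent cost divided by minimum agent cost. -/
def FR (s : Fin (n + 1) → Fin (n + 1)) : ℝ≥0∞ :=
  (⨆ (v : Fin (n + 1)) (_ : v ≠ 0), cost 0 s v) /
    (⨅ (v : Fin (n + 1)) (_ : v ≠ 0), cost 0 s v)

/-- The length of the path from `v` to the root `0`. -/
def level (s : Fin (n + 1) → Fin (n + 1)) (v : Fin (n + 1)) : ℕ :=
  sInf {k | s^[k] v = 0}

section Level

variable {s : Fin (n + 1) → Fin (n + 1)}

theorem iterate_level (htree : ∀ v, ∃ k, s^[k] v = 0) (v : Fin (n + 1)) :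
    s^[level s v] v = 0 :=
  Nat.sInf_mem (s := {k | s^[k] v = 0}) (htree v)

theorem iterate_ne_of_lt_level {v : Fin (n + 1)} {j : ℕ} (hj : j < level s v) :
    s^[j] v ≠ 0 :=
  fun hz => Nat.notMem_of_lt_sInf (s := {k | s^[k] v = 0}) hj hz

theorem level_zero : level s 0 = 0 :=
  Nat.sInf_eq_zero.2 (Or.inl rfl)

theorem level_pos (htree : ∀ v, ∃ k, s^[k] v = 0) {v : Fin (n + 1)} (hv : v ≠ 0) :
    0 < level s v := by
  rcases Nat.eq_zero_or_pos (level s v) with h0 | h0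
  · have := iterate_level htree v
    rw [h0] at this
    exact absurd this hv
  · exact h0

theorem iterate_zero_root (hs0 : s 0 = 0) (k : ℕ) : s^[k] 0 = 0 :=
  Function.iterate_fixed hs0 k

theorem level_iterate_add (htree : ∀ v, ∃ k, s^[k] v = 0) {v : Fin (n + 1)} {k : ℕ}
    (hk : k ≤ level s v) : level s (s^[k] v) + k = level s v := by
  apply le_antisymm
  · have : level s (s^[k] v) ≤ level s v - k := by
      apply Nat.sInf_le
      change s^[level s v - k] (s^[k] v) = 0
      rw [← Function.iterate_add_apply, Nat.sub_add_cancel hk]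
      exact iterate_level htree v
    omega
  · apply Nat.sInf_le
    change s^[level s (s^[k] v) + k] v = 0
    rw [Function.iterate_add_apply]
    exact iterate_level htree _

theorem level_apply_add_one (htree : ∀ v, ∃ k, s^[k] v = 0) {v : Fin (n + 1)} (hv : v ≠ 0) :
    level s (s v) + 1 = level s v :=
  level_iterate_add (k := 1) htree (level_pos htree hv)

theorem level_add_of_iterate_eq (hs0 : s 0 = 0) (htree : ∀ v, ∃ k, s^[k] v = 0)
    {w v : Fin (n + 1)} (hv : v ≠ 0) {k : ℕ} (hk : s^[k] w = v) :
    level s v + k = level s w := by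
  have hle : k ≤ level s w := by
    by_contra hlt
    push Not at hlt
    apply hv
    rw [← hk, ← Nat.sub_add_cancel hlt.le, Function.iterate_add_apply, iterate_level htree,
      iterate_zero_root hs0]
  rw [← hk]
  exact level_iterate_add htree hle

end Level

theorem cost_eq_sum {r v : Fin (n + 1)} {s : Fin (n + 1) → Fin (n + 1)} {k : ℕ}
    (hk : s^[k] v = r) (hlt : ∀ j < k, s^[j] v ≠ r) :
    cost r s v = ∑ j ∈ Finset.range k,
      (indeg r s (s^[j + 1] v) : ℝ≥0∞) / (subtreeSize s (s^[j] v) : ℝ≥0∞) := by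
  have hex : ∃ k, s^[k] v = r := ⟨k, hk⟩
  have hfind : Nat.find hex = k := (Nat.find_eq_iff hex).2 ⟨hk, hlt⟩
  rw [cost, dif_pos hex, hfind]

section Tree

variable {s : Fin (n + 1) → Fin (n + 1)}

/-- The nodes having a directed path to `u`. -/
def subtree (s : Fin (n + 1) → Fin (n + 1)) (u : Fin (n + 1)) : Finset (Fin (n + 1)) :=
  {w | ∃ k, s^[k] w = u}

theorem mem_subtree {u w : Fin (n + 1)} : w ∈ subtree s u ↔ ∃ k, s^[k] w = u := by
  simp [subtree]

theorem subtreeSize_eq_card (s : Fin (n + 1) → Fin (n + 1)) (u : Fin (n + 1)) :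
    subtreeSize s u = (subtree s u).card := by
  rw [subtreeSize, subtree, Nat.card_eq_fintype_card, ← Set.toFinset_card]
  congr 1
  ext w
  simp

/-- The agents whose activated edge points to `u`. -/
def children (s : Fin (n + 1) → Fin (n + 1)) (u : Fin (n + 1)) : Finset (Fin (n + 1)) :=
  {w | w ≠ 0 ∧ s w = u}

theorem mem_children {u w : Fin (n + 1)} : w ∈ children s u ↔ w ≠ 0 ∧ s w = u := by
  simp [children]

theorem indeg_eq_card (s : Fin (n + 1) → Fin (n + 1)) (u : Fin (n + 1)) :
    indeg 0 s u = (children s u).card := by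
  rw [indeg, children, Nat.card_eq_fintype_card, ← Set.toFinset_card]
  congr 1
  ext w
  simp

theorem subtree_eq_insert_biUnion (hs0 : s 0 = 0) (u : Fin (n + 1)) :
    subtree s u = insert u ((children s u).biUnion (subtree s)) := by
  ext w
  simp only [mem_subtree, Finset.mem_insert, Finset.mem_biUnion, mem_children]
  constructor
  · rintro ⟨k, hk⟩
    induction k generalizing w with
    | zero => exact Or.inl hk
    | succ k ih =>
      by_cases hw : w = 0
      · subst hw
        rw [iterate_zero_root hs0] at hk
        exact Or.inl hk
      rw [Function.iterate_succ_apply] at hk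
      rcases ih _ hk with h1 | ⟨a, ha, j, hj⟩
      · exact Or.inr ⟨w, ⟨hw, h1⟩, 0, rfl⟩
      · exact Or.inr ⟨a, ha, j + 1, by rw [Function.iterate_succ_apply]; exact hj⟩
  · rintro (rfl | ⟨a, ⟨-, ha⟩, j, hj⟩)
    · exact ⟨0, rfl⟩
    · exact ⟨j + 1, by rw [Function.iterate_succ_apply', hj, ha]⟩

theorem card_subtree (hs0 : s 0 = 0) (htree : ∀ v, ∃ k, s^[k] v = 0) (u : Fin (n + 1)) :
    (subtree s u).card = 1 + ∑ w ∈ children s u, (subtree s w).card := by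
  rw [subtree_eq_insert_biUnion hs0, Finset.card_insert_of_notMem, Finset.card_biUnion, add_comm]
  · intro a ha b hb hab
    rw [Function.onFun, Finset.disjoint_left]
    intro w hwa hwb
    obtain ⟨i, hi⟩ := mem_subtree.1 hwa
    obtain ⟨j, hj⟩ := mem_subtree.1 hwb
    obtain ⟨ha0, hau⟩ := mem_children.1 ha
    obtain ⟨hb0, hbu⟩ := mem_children.1 hb
    have h1 := level_add_of_iterate_eq hs0 htree ha0 hi
    have h2 := level_add_of_iterate_eq hs0 htree hb0 hj
    have h3 := level_apply_add_one htree ha0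
    have h4 := level_apply_add_one htree hb0
    rw [hau] at h3
    rw [hbu] at h4
    have : i = j := by omega
    subst this
    exact hab (hi.symm.trans hj)
  · simp only [Finset.mem_biUnion, not_exists, not_and]
    intro a ha hu
    obtain ⟨i, hi⟩ := mem_subtree.1 hu
    obtain ⟨ha0, hau⟩ := mem_children.1 ha
    have h1 := level_add_of_iterate_eq hs0 htree ha0 hi
    have h3 := level_apply_add_one htree ha0
    rw [hau] at h3
    omega

theorem card_subtree_of_level (hs0 : s 0 = 0) (htree : ∀ v, ∃ k, s^[k] v = 0) {h : ℕ}
    {d t : ℕ → ℕ} (hdeg : ∀ v, (children s v).card = d (level s v)) (hdh : d h = 0)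
    (hth : t h = 1) (ht : ∀ i < h, t i = 1 + d i * t (i + 1)) :
    ∀ (j : ℕ) (v : Fin (n + 1)), level s v + j = h → (subtree s v).card = t (level s v) := by
  intro j
  induction j with
  | zero =>
    intro v hv
    have hv : level s v = h := hv
    have : children s v = ∅ := by rw [← Finset.card_eq_zero, hdeg, hv, hdh]
    rw [card_subtree hs0 htree, this, hv, hth]
    rfl
  | succ j ih =>
    intro v hv
    rw [card_subtree hs0 htree, ht _ (by omega), Finset.sum_const_nat (m := t (level s v + 1)), hdeg]
    intro w hw
    obtain ⟨hw0, hwv⟩ := mem_children.1 hw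
    have := level_apply_add_one htree hw0
    rw [hwv] at this
    rw [this]
    exact ih w (by omega)

theorem update_iterate_of_notMem {v a w : Fin (n + 1)} (hw : w ∉ subtree s v) (k : ℕ) :
    (Function.update s v a)^[k] w = s^[k] w := by
  induction k with
  | zero => rfl
  | succ k ih =>
    rw [Function.iterate_succ_apply', ih, Function.iterate_succ_apply', Function.update_of_ne]
    exact fun he => hw (mem_subtree.2 ⟨k, he⟩)

theorem subtree_subset_update_self (v a : Fin (n + 1)) :
    subtree s v ⊆ subtree (Function.update s v a) v := by
  intro w hw
  obtain ⟨k, hk⟩ := mem_subtree.1 hw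
  induction k generalizing w with
  | zero => exact mem_subtree.2 ⟨0, hk⟩
  | succ k ih =>
    by_cases hwv : w = v
    · exact mem_subtree.2 ⟨0, hwv⟩
    · rw [Function.iterate_succ_apply] at hk
      obtain ⟨j, hj⟩ := mem_subtree.1 (ih (mem_subtree.2 ⟨k, hk⟩) hk)
      exact mem_subtree.2
        ⟨j + 1, by rw [Function.iterate_succ_apply, Function.update_of_ne hwv]; exact hj⟩

theorem union_subset_subtree_update {v a : Fin (n + 1)} (ha : a ∉ subtree s v) (k : ℕ) :
    subtree s (s^[k] a) ∪ subtree s v ⊆ subtree (Function.update s v a) (s^[k] a) := by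
  have hv : ∀ w ∈ subtree s v, w ∈ subtree (Function.update s v a) (s^[k] a) := by
    intro w hw
    obtain ⟨j, hj⟩ := mem_subtree.1 (subtree_subset_update_self v a hw)
    refine mem_subtree.2 ⟨k + (1 + j), ?_⟩
    rw [Function.iterate_add_apply, Function.iterate_add_apply, hj, Function.iterate_one,
      Function.update_self, update_iterate_of_notMem ha]
  intro w hw
  by_cases hwv : w ∈ subtree s v
  · exact hv w hwv
  · rcases Finset.mem_union.1 hw with h1 | h1
    · obtain ⟨j, hj⟩ := mem_subtree.1 h1
      exact mem_subtree.2 ⟨j, by rw [update_iterate_of_notMem hwv, hj]⟩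
    · exact absurd h1 hwv

theorem card_children_update_le (v a : Fin (n + 1)) :
    (children (Function.update s v a) a).card ≤ (children s a).card + 1 := by
  refine (Finset.card_le_card ?_).trans (Finset.card_insert_le v (children s a))
  intro w hw
  obtain ⟨hw0, hwa⟩ := mem_children.1 hw
  by_cases hwv : w = v
  · exact Finset.mem_insert.2 (Or.inl hwv)
  · rw [Function.update_of_ne hwv] at hwa
    exact Finset.mem_insert_of_mem (mem_children.2 ⟨hw0, hwa⟩)

theorem children_update_subset_of_ne {v a u : Fin (n + 1)} (hu : u ≠ a) :
    children (Function.update s v a) u ⊆ children s u := by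
  intro w hw
  obtain ⟨hw0, hwa⟩ := mem_children.1 hw
  by_cases hwv : w = v
  · subst hwv
    rw [Function.update_self] at hwa
    exact absurd hwa.symm hu
  · rw [Function.update_of_ne hwv] at hwa
    exact mem_children.2 ⟨hw0, hwa⟩

theorem cost_eq_sum_level (htree : ∀ v, ∃ k, s^[k] v = 0) (v : Fin (n + 1)) :
    cost 0 s v = ∑ j ∈ Finset.range (level s v),
      ((children s (s^[j + 1] v)).card : ℝ≥0∞) / ((subtree s (s^[j] v)).card : ℝ≥0∞) := by
  rw [cost_eq_sum (iterate_level htree v) fun j hj => iterate_ne_of_lt_level hj]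
  simp only [indeg_eq_card, subtreeSize_eq_card]

theorem cost_update_le (htree : ∀ v, ∃ k, s^[k] v = 0) {v a : Fin (n + 1)}
    (hv : v ≠ 0) (ha : a ∉ subtree s v) :
    cost 0 (Function.update s v a) v ≤
      (((children s a).card + 1 : ℕ) : ℝ≥0∞) / ((subtree s v).card : ℝ≥0∞) +
      ∑ j ∈ Finset.range (level s a),
        ((children s (s^[j + 1] a)).card : ℝ≥0∞) /
          ((subtree s (s^[j] a) ∪ subtree s v).card : ℝ≥0∞) := by
  have hit : ∀ k, (Function.update s v a)^[k + 1] v = s^[k] a := by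
    intro k
    rw [Function.iterate_succ_apply, Function.update_self, update_iterate_of_notMem ha]
  rw [cost_eq_sum (k := level s a + 1)]
  rotate_left
  · rw [hit, iterate_level htree]
  · rintro (_ | j) hj
    · exact hv
    · rw [hit]
      exact iterate_ne_of_lt_level (by omega)
  rw [Finset.sum_range_succ', add_comm]
  simp only [indeg_eq_card, subtreeSize_eq_card, hit, Function.iterate_zero, id_eq]
  gcongr with j hj
  · exact card_children_update_le v a
  · exact subtree_subset_update_self v a
  · apply children_update_subset_of_ne
    intro he
    have hj := Finset.mem_range.1 hj
    have := level_iterate_add htree (Nat.succ_le_of_lt hj)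
    rw [he] at this
    omega
  · exact union_subset_subtree_update ha j

end Tree

section Real

theorem le_mul_log {k u : ℝ} (hk : 4 ≤ k) (hu2 : 2 ≤ u)
    (hu : 2 * u ≤ 3.67 + k * Real.log k) : u ≤ 0.849 * k * Real.log u := by
  have hl2 : 0.6931471803 < Real.log 2 := Real.log_two_gt_d9
  have hl4 : Real.log 4 = 2 * Real.log 2 := by
    rw [show (4 : ℝ) = 2 ^ 2 by norm_num, Real.log_pow]; norm_num
  rcases le_total u 4 with h4 | h4
  · have hchord : Real.log 2 / 2 * u ≤ Real.log u := by
      have hc := (strictConcaveOn_log_Ioi.concaveOn).2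
        (show (2 : ℝ) ∈ Set.Ioi 0 by simp) (show (4 : ℝ) ∈ Set.Ioi 0 by simp)
        (by linarith : (0 : ℝ) ≤ (4 - u) / 2) (by linarith : (0 : ℝ) ≤ (u - 2) / 2) (by ring)
      simp only [smul_eq_mul] at hc
      rw [hl4, show (4 - u) / 2 * 2 + (u - 2) / 2 * 4 = u by ring] at hc
      linarith
    have h1 : 0.34 * u ≤ Real.log u := by nlinarith
    have h2 : 0 ≤ Real.log u := by linarith
    nlinarith
  · have hlogu : Real.log 4 ≤ Real.log u := Real.log_le_log (by norm_num) h4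
    rcases le_total u k with huk | huk
    · nlinarith
    · have h1 : Real.log k ≤ Real.log u := Real.log_le_log (by linarith) huk
      have h2 : Real.log 4 ≤ Real.log k := Real.log_le_log (by norm_num) hk
      nlinarith

theorem factorial_succ_le_succ_pow (m : ℕ) : (m + 1).factorial ≤ (m + 1) ^ m := by
  induction m with
  | zero => simp
  | succ m ih =>
    rw [Nat.factorial_succ, pow_succ']
    exact Nat.mul_le_mul_left _ (ih.trans (Nat.pow_le_pow_left (by omega) m))

theorem mul_factorial_le_pow {k : ℕ} (hk : k ≠ 0) : k * k.factorial ≤ k ^ k := by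
  obtain ⟨m, rfl⟩ := Nat.exists_eq_succ_of_ne_zero hk
  rw [pow_succ']
  exact Nat.mul_le_mul_left _ (factorial_succ_le_succ_pow m)

theorem sq_log_le {n k : ℕ} (hk : 4 ≤ k) (hn : 20 ≤ n) (hnk : n ≤ 12 * (k * k.factorial)) {c : ℝ}
    (hc : c ≤ 3.3715) :
    c * n / (k : ℝ) ^ 2 ≤ 2.4318 * (n : ℝ) *
        (Real.log (Real.log (4 * Real.sqrt ((n : ℝ) / 5)))) ^ 2 /
          (Real.log (4 * Real.sqrt ((n : ℝ) / 5))) ^ 2 := by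
  have hn' : (20 : ℝ) ≤ n := by exact_mod_cast hn
  have hk' : (4 : ℝ) ≤ k := by exact_mod_cast hk
  generalize hx : 4 * Real.sqrt ((n : ℝ) / 5) = x
  have hx2 : x ^ 2 = 16 / 5 * n := by
    rw [← hx, mul_pow, Real.sq_sqrt (by positivity)]; ring
  have hx0 : 0 ≤ x := by rw [← hx]; positivity
  have hx8 : 8 ≤ x := by nlinarith
  set u := Real.log x with hu
  have hu2 : 2 ≤ u := by
    have : Real.log 8 ≤ u := Real.log_le_log (by norm_num) hx8
    rw [show (8 : ℝ) = 2 ^ 3 by norm_num, Real.log_pow] at this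
    have := Real.log_two_gt_d9
    push_cast at *
    linarith
  have hup : 2 * u ≤ 3.67 + k * Real.log k := by
    have h1 : x ^ 2 ≤ 38.4 * (k : ℝ) ^ k := by
      have h2 : n ≤ 12 * k ^ k := hnk.trans (Nat.mul_le_mul_left _ (mul_factorial_le_pow (by omega)))
      have h3 : (n : ℝ) ≤ 12 * (k : ℝ) ^ k := by exact_mod_cast h2
      rw [hx2]; linarith
    have h4 := Real.log_le_log (by positivity) h1
    rw [Real.log_pow (x := x), ← hu, Real.log_mul (by norm_num) (by positivity), Real.log_pow] at h4
    have h5 : Real.log 38.4 ≤ 3.67 := by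
      rw [show (38.4 : ℝ) = 2 ^ 5 * 1.2 by norm_num, Real.log_mul (by norm_num) (by norm_num),
        Real.log_pow]
      have h6 := Real.log_two_lt_d9
      have h7 := Real.log_le_sub_one_of_pos (show (0 : ℝ) < 1.2 by norm_num)
      push_cast
      linarith
    push_cast at h4
    linarith
  have hlog := le_mul_log hk' hu2 hup
  rw [div_le_div_iff₀ (by positivity) (by positivity)]
  have hsq : u ^ 2 ≤ (0.849 * k * Real.log u) ^ 2 := by gcongr
  calc c * n * u ^ 2 ≤ 3.3715 * n * (0.849 * k * Real.log u) ^ 2 := by gcongr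
    _ ≤ 2.4318 * n * Real.log u ^ 2 * (k : ℝ) ^ 2 := by
      have : 0 ≤ n * Real.log u ^ 2 * (k : ℝ) ^ 2 := by positivity
      nlinarith

end Real

section LevelCosts

variable {s : Fin (n + 1) → Fin (n + 1)} {d t : ℕ → ℕ}

/-- The cost of an agent at distance `i` from the root of a balanced tree in which the nodes at
distance `j` have in-degree `d j` and subtrees of size `t j`. -/
def levelCost (d t : ℕ → ℕ) (i : ℕ) : ℝ :=
  ∑ j ∈ Finset.range i, (d j : ℝ) / t (j + 1)

theorem levelCost_nonneg (i : ℕ) : 0 ≤ levelCost d t i :=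
  Finset.sum_nonneg fun _ _ => by positivity

theorem levelCost_succ (i : ℕ) :
    levelCost d t (i + 1) = levelCost d t i + (d i : ℝ) / t (i + 1) :=
  Finset.sum_range_succ _ _

theorem levelCost_mono : Monotone (levelCost d t) :=
  monotone_nat_of_le_succ fun i => by
    rw [levelCost_succ]
    exact le_add_of_nonneg_right (by positivity)

theorem ofReal_natCast_div (a : ℕ) {b : ℕ} (hb : 0 < b) :
    ENNReal.ofReal ((a : ℝ) / b) = (a : ℝ≥0∞) / b := by
  rw [ENNReal.ofReal_div_of_pos (by exact_mod_cast hb), ENNReal.ofReal_natCast,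
    ENNReal.ofReal_natCast]

theorem sum_path_eq_levelCost (htree : ∀ v, ∃ k, s^[k] v = 0) (htpos : ∀ i, 0 < t i)
    (hdeg : ∀ v, (children s v).card = d (level s v))
    (hsub : ∀ v, (subtree s v).card = t (level s v)) (v : Fin (n + 1)) :
    ∑ j ∈ Finset.range (level s v),
      ((children s (s^[j + 1] v)).card : ℝ≥0∞) / ((subtree s (s^[j] v)).card : ℝ≥0∞) =
    ENNReal.ofReal (levelCost d t (level s v)) := by
  rw [levelCost, ENNReal.ofReal_sum_of_nonneg fun _ _ => by positivity,
    ← Finset.sum_range_reflect]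
  refine Finset.sum_congr rfl fun j hj => ?_
  have hj := Finset.mem_range.1 hj
  have h1 := level_iterate_add htree (v := v) (k := level s v - 1 - j) (by omega)
  have h2 := level_iterate_add htree (v := v) (k := level s v - 1 - j + 1) (by omega)
  rw [hdeg, hsub, show level s (s^[level s v - 1 - j] v) = j + 1 by omega,
    show level s (s^[level s v - 1 - j + 1] v) = j by omega, ofReal_natCast_div _ (htpos _)]

theorem cost_eq_levelCost (htree : ∀ v, ∃ k, s^[k] v = 0) (htpos : ∀ i, 0 < t i)
    (hdeg : ∀ v, (children s v).card = d (level s v))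
    (hsub : ∀ v, (subtree s v).card = t (level s v)) (v : Fin (n + 1)) :
    cost 0 s v = ENNReal.ofReal (levelCost d t (level s v)) := by
  rw [cost_eq_sum_level htree, sum_path_eq_levelCost htree htpos hdeg hsub]

theorem notMem_subtree_of_level_lt (hs0 : s 0 = 0) (htree : ∀ v, ∃ k, s^[k] v = 0)
    {v a : Fin (n + 1)} (hlt : level s a < level s v) : a ∉ subtree s v := by
  intro ha
  obtain ⟨k, hk⟩ := mem_subtree.1 ha
  have hv : v ≠ 0 := by
    rintro rfl
    rw [level_zero] at hlt
    omega
  have := level_add_of_iterate_eq hs0 htree hv hk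
  omega

theorem IsStable.levelCost_le_grandparent (hstable : IsStable 0 s)
    (htree : ∀ v, ∃ k, s^[k] v = 0) (htpos : ∀ i, 0 < t i)
    (hdeg : ∀ v, (children s v).card = d (level s v))
    (hsub : ∀ v, (subtree s v).card = t (level s v)) {v : Fin (n + 1)} {i : ℕ}
    (hv : level s v = i + 2) :
    levelCost d t (i + 2) ≤ ((d i + 1 : ℕ) : ℝ) / t (i + 2) + levelCost d t i := by
  have hs0 : s 0 = 0 := hstable.1.1
  have hv0 : v ≠ 0 := by
    rintro rfl
    rw [level_zero] at hv
    omega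
  have ha : level s (s^[2] v) = i := by
    have := level_iterate_add htree (v := v) (k := 2) (by omega)
    omega
  have hnot : s^[2] v ∉ subtree s v := notMem_subtree_of_level_lt hs0 htree (by omega)
  have hne : s^[2] v ≠ v := fun he => hnot (mem_subtree.2 ⟨0, he⟩)
  have h1 := (hstable.2 v hv0 _ hne).trans (cost_update_le htree hv0 hnot)
  have h2 : cost 0 s v ≤ ENNReal.ofReal
      (((d i + 1 : ℕ) : ℝ) / t (i + 2) + levelCost d t i) := by
    rw [ENNReal.ofReal_add (by positivity) (levelCost_nonneg i), ofReal_natCast_div _ (htpos _)]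
    refine h1.trans ?_
    rw [hdeg, hsub, ha, hv]
    gcongr
    rw [← ha, ← sum_path_eq_levelCost htree htpos hdeg hsub]
    gcongr
    exact Finset.subset_union_left
  rw [cost_eq_levelCost htree htpos hdeg hsub, hv] at h2
  exact (ENNReal.ofReal_le_ofReal_iff
    (add_nonneg (by positivity) (levelCost_nonneg i))).1 h2

theorem IsStable.levelCost_le_uncle (hstable : IsStable 0 s)
    (htree : ∀ v, ∃ k, s^[k] v = 0) (htpos : ∀ i, 0 < t i)
    (hdeg : ∀ v, (children s v).card = d (level s v))
    (hsub : ∀ v, (subtree s v).card = t (level s v)) {v : Fin (n + 1)} {i : ℕ}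
    (hv : level s v = i + 3) (hdi : 2 ≤ d i) :
    levelCost d t (i + 3) ≤ ((d (i + 1) + 1 : ℕ) : ℝ) / t (i + 3) +
      ((d i : ℝ) / (t (i + 1) + t (i + 3) : ℕ) + levelCost d t i) := by
  have hs0 : s 0 = 0 := hstable.1.1
  have hv0 : v ≠ 0 := by
    rintro rfl
    rw [level_zero] at hv
    omega
  have hz : level s (s^[3] v) = i := by
    have := level_iterate_add htree (v := v) (k := 3) (by omega)
    omega
  obtain ⟨a, ha, hav⟩ : ∃ a ∈ children s (s^[3] v), a ≠ s^[2] v :=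
    Finset.exists_mem_ne (by rw [hdeg, hz]; omega) _
  obtain ⟨ha0, hsa⟩ := mem_children.1 ha
  have hla : level s a = i + 1 := by
    rw [← level_apply_add_one htree ha0, hsa, hz]
  have hnot : a ∉ subtree s v := notMem_subtree_of_level_lt hs0 htree (by omega)
  have hne : a ≠ v := fun he => hnot (mem_subtree.2 ⟨0, he⟩)
  have hdisj : Disjoint (subtree s a) (subtree s v) := by
    rw [Finset.disjoint_left]
    intro w hwa hwv
    obtain ⟨p, hp⟩ := mem_subtree.1 hwa
    obtain ⟨q, hq⟩ := mem_subtree.1 hwv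
    have h1 := level_add_of_iterate_eq hs0 htree ha0 hp
    have h2 := level_add_of_iterate_eq hs0 htree hv0 hq
    have h3 : p = 2 + q := by omega
    rw [h3, Function.iterate_add_apply, hq] at hp
    exact hav hp.symm
  have h1 := (hstable.2 v hv0 _ hne).trans (cost_update_le htree hv0 hnot)
  have h2 : cost 0 s v ≤ ENNReal.ofReal (((d (i + 1) + 1 : ℕ) : ℝ) / t (i + 3) +
      ((d i : ℝ) / (t (i + 1) + t (i + 3) : ℕ) + levelCost d t i)) := by
    have hn := levelCost_nonneg (d := d) (t := t) i
    rw [ENNReal.ofReal_add (by positivity) (by positivity),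
      ENNReal.ofReal_add (by positivity) (levelCost_nonneg i), ofReal_natCast_div _ (htpos _),
      ofReal_natCast_div _ (add_pos (htpos _) (htpos _))]
    refine h1.trans ?_
    rw [hla, Finset.sum_range_succ', hdeg, hsub, hla, hv]
    simp only [zero_add, Function.iterate_one, Function.iterate_zero, id_eq]
    rw [hsa, Finset.card_union_of_disjoint hdisj, hdeg, hsub, hsub, hla, hv, hz,
      add_comm (Finset.sum _ _)]
    gcongr
    have hpath := sum_path_eq_levelCost htree htpos hdeg hsub (s^[3] v)
    rw [hz] at hpath
    rw [← hpath]
    refine Finset.sum_le_sum fun j _ => ?_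
    rw [Function.iterate_succ_apply, Function.iterate_succ_apply s j a, hsa]
    gcongr
    exact Finset.subset_union_left
  rw [cost_eq_levelCost htree htpos hdeg hsub, hv] at h2
  have hn := levelCost_nonneg (d := d) (t := t) i
  exact (ENNReal.ofReal_le_ofReal_iff (by positivity)).1 h2

end LevelCosts

section DegreeSequence

variable {h : ℕ} {d t : ℕ → ℕ}

theorem degree_le_of_levelCost_le {i : ℕ} (htpos : ∀ i, 0 < t i) (hd : 2 ≤ d (i + 1))
    (hcost : levelCost d t (i + 2) ≤
      ((d i + 1 : ℕ) : ℝ) / t (i + 2) + levelCost d t i) : d (i + 1) ≤ d i := by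
  have ht1 : (0 : ℝ) < t (i + 1) := by exact_mod_cast htpos _
  have ht2 : (0 : ℝ) < t (i + 2) := by exact_mod_cast htpos _
  rw [levelCost_succ, levelCost_succ] at hcost
  have h1 : (d i : ℝ) / t (i + 1) + d (i + 1) / t (i + 2) ≤ ((d i + 1 : ℕ) : ℝ) / t (i + 2) := by
    rw [show i + 1 + 1 = i + 2 from rfl] at hcost
    linarith
  by_contra! hlt
  have h2 : ((d i + 1 : ℕ) : ℝ) / t (i + 2) ≤ (d (i + 1) : ℝ) / t (i + 2) := by
    gcongr
    omega
  have h3 : (d i : ℝ) / t (i + 1) ≤ 0 := by linarith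
  have h4 : d i ≠ 0 → False := by
    intro h5
    have : (0 : ℝ) < d i := by exact_mod_cast Nat.pos_of_ne_zero h5
    have : 0 < (d i : ℝ) / t (i + 1) := by positivity
    linarith
  have h5 : d i = 0 := by tauto
  rw [h5] at h1
  have h6 : (d (i + 1) : ℝ) / t (i + 2) ≤ 1 / t (i + 2) := by simpa using h1
  rw [div_le_div_iff_of_pos_right ht2] at h6
  have : d (i + 1) ≤ 1 := by exact_mod_cast h6
  omega

theorem lt_sq_add_two_of_uncle {d f T : ℝ} (hd : 4 ≤ d) (hf : d ≤ f) (hT : 1 ≤ T)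
    (hle : d / T + d / (1 + d * T) + f / (1 + d * (1 + d * T)) ≤
      (d + 1) / T + f / (1 + d * (1 + d * T) + T)) : T < d ^ 2 + 2 := by
  by_contra! hlt
  have e1 : d / T + d / (1 + d * T) + f / (1 + d * (1 + d * T)) -
      ((d + 1) / T + f / (1 + d * (1 + d * T) + T)) =
      (f * T ^ 2 * (1 + d * T) - (1 + d * (1 + d * T)) * (1 + d * (1 + d * T) + T)) /
        ((1 + d * (1 + d * T)) * (1 + d * (1 + d * T) + T) * (T * (1 + d * T))) := by
    have : 1 + d * T ≠ 0 := by positivity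
    have : 1 + d * (1 + d * T) ≠ 0 := by positivity
    have : 1 + d * (1 + d * T) + T ≠ 0 := by positivity
    field_simp
    ring
  have hden : 0 < (1 + d * (1 + d * T)) * (1 + d * (1 + d * T) + T) * (T * (1 + d * T)) := by
    positivity
  have h1 : (f * T ^ 2 * (1 + d * T) - (1 + d * (1 + d * T)) * (1 + d * (1 + d * T) + T)) /
        ((1 + d * (1 + d * T)) * (1 + d * (1 + d * T) + T) * (T * (1 + d * T))) ≤ 0 := by
    rw [← e1]; linarith
  rw [div_nonpos_iff] at h1
  have h2 : f * T ^ 2 * (1 + d * T) ≤ (1 + d * (1 + d * T)) * (1 + d * (1 + d * T) + T) := by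
    rcases h1 with h1 | h1 <;> linarith [h1.1, h1.2]
  have h3 : d * T ^ 2 * (1 + d * T) ≤ f * T ^ 2 * (1 + d * T) := by gcongr
  have h4 : (d ^ 2 + 2) * (d ^ 2 * T ^ 2) ≤ T * (d ^ 2 * T ^ 2) := by gcongr
  have h5 : (d ^ 2 + 2) * ((d ^ 2 + d) * T) ≤ T * ((d ^ 2 + d) * T) := by gcongr
  have h6 : (d ^ 2 + d) * T ^ 2 ≤ (1 + d) ^ 2 + (1 + d) * (2 * d ^ 2 + 1) * T := by
    nlinarith
  have h7 : (1 + d) * ((d ^ 3 - 2 * d ^ 2 + 2 * d - 1) * T) ≤ (1 + d) * (1 + d) := by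
    nlinarith
  have h8 := le_of_mul_le_mul_left h7 (by linarith)
  have h9 : 2 * d ^ 2 ≤ d ^ 3 := by nlinarith [sq_nonneg d]
  nlinarith

theorem pow_four_add_le_factorial {m : ℕ} (hm : 4 ≤ m) :
    m ^ 4 + m ^ 2 + m + 2 ≤ 12 * m.factorial := by
  induction m, hm using Nat.le_induction with
  | base => decide
  | succ m hm ih =>
    rw [Nat.factorial_succ]
    have h1 : (m + 1) ^ 4 + (m + 1) ^ 2 + (m + 1) + 2 ≤ (m + 1) * (m ^ 4 + m ^ 2 + m + 2) := by
      obtain ⟨k, rfl⟩ := Nat.exists_eq_add_of_le hm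
      ring_nf
      nlinarith [Nat.zero_le (k ^ 3), Nat.zero_le (k ^ 4), Nat.zero_le (k ^ 5), Nat.zero_le (k ^ 2)]
    calc _ ≤ _ := h1
      _ ≤ (m + 1) * (12 * m.factorial) := Nat.mul_le_mul_left _ ih
      _ = _ := by ring

theorem four_le_degree (hd3 : d (h - 3) = 4)
    (hmono : ∀ i, i + 2 ≤ h → 2 ≤ d (i + 1) → d (i + 1) ≤ d i) {i : ℕ} (hi : i ≤ h - 3) :
    4 ≤ d i := by
  induction hi using Nat.decreasingInduction with
  | self => exact hd3.ge
  | of_succ i hi ih => exact ih.trans (hmono i (by omega) (by omega))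

theorem size_add_one_le_factorial (htpos : ∀ i, 0 < t i) (ht : ∀ i < h, t i = 1 + d i * t (i + 1))
    (hd3 : d (h - 3) = 4) (ht3 : t (h - 3) = 21)
    (hmono : ∀ i, i + 2 ≤ h → 2 ≤ d (i + 1) → d (i + 1) ≤ d i)
    (huncle : ∀ i, i + 3 ≤ h → 2 ≤ d i →
      levelCost d t (i + 3) ≤ ((d (i + 1) + 1 : ℕ) : ℝ) / t (i + 3) +
        ((d i : ℝ) / (t (i + 1) + t (i + 3) : ℕ) + levelCost d t i))
    {i : ℕ} (hi : i + 1 ≤ h - 3) : t (i + 1) + 1 ≤ 12 * (d (i + 1)).factorial := by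
  have hd4 := fun j hj => four_le_degree (i := j) hd3 hmono hj
  suffices H : ∀ j, j ≤ h - 3 → 1 ≤ j → t j + 1 ≤ 12 * (d j).factorial from H _ hi (by omega)
  intro j hj
  induction hj using Nat.decreasingInduction with
  | self =>
    intro _
    rw [ht3, hd3]
    decide
  | of_succ j hj ih =>
    intro hj1
    obtain ⟨i, rfl⟩ := Nat.exists_eq_add_of_le' hj1
    have ih := ih (by omega)
    have hle := hmono (i + 1) (by omega) (by linarith [hd4 (i + 1 + 1) (by omega)])
    have hle0 := hmono i (by omega) (by linarith [hd4 (i + 1) (by omega)])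
    have h4 := hd4 (i + 1) (by omega)
    have e1 := ht (i + 1) (by omega)
    have e2 := ht (i + 2) (by omega)
    rcases hle.eq_or_lt with heq | hlt
    · have hu := huncle i (by omega) (by linarith [hd4 i (by omega)])
      simp only [levelCost_succ] at hu
      rw [show i + 1 + 1 = i + 2 from rfl] at *
      rw [show i + 2 + 1 = i + 3 from rfl] at *
      rw [heq] at hu e2
      push_cast at hu
      rw [e2] at e1
      rw [e1, e2] at hu
      push_cast at hu
      have hT := lt_sq_add_two_of_uncle (d := d (i + 1)) (f := d i) (T := t (i + 3))
        (by exact_mod_cast h4) (by exact_mod_cast hle0) (by exact_mod_cast htpos (i + 3))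
        (by linarith)
      have hT' : t (i + 3) < d (i + 1) ^ 2 + 2 := by exact_mod_cast hT
      have hfac := pow_four_add_le_factorial h4
      have hT2 : t (i + 3) ≤ d (i + 1) ^ 2 + 1 := by omega
      calc t (i + 1) + 1 = 2 + d (i + 1) + d (i + 1) ^ 2 * t (i + 3) := by rw [e1]; ring
        _ ≤ 2 + d (i + 1) + d (i + 1) ^ 2 * (d (i + 1) ^ 2 + 1) := by gcongr
        _ = d (i + 1) ^ 4 + d (i + 1) ^ 2 + d (i + 1) + 2 := by ring
        _ ≤ _ := hfac
    · obtain ⟨e, he⟩ : ∃ e, d (i + 1) = e + 1 := ⟨d (i + 1) - 1, by omega⟩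
      have hfac : (d (i + 1 + 1)).factorial ≤ e.factorial := Nat.factorial_le (by omega)
      rw [e1, he, Nat.factorial_succ]
      have h5 : (e + 1) * (t (i + 1 + 1) + 1) ≤ (e + 1) * (12 * e.factorial) :=
        Nat.mul_le_mul_left _ (by omega)
      have h6 : 3 ≤ e := by omega
      nlinarith

theorem levelCost_height_le (h3 : 3 ≤ h) (htpos : ∀ i, 0 < t i)
    (ht : ∀ i < h, t i = 1 + d i * t (i + 1)) (hth : t h = 1)
    (hd1 : d (h - 1) = 1) (hd2 : d (h - 2) = 2) (hd3 : d (h - 3) = 4)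
    (ht3 : t (h - 3) = 21) (hd4 : ∀ i ≤ h - 3, 4 ≤ d i)
    (hseq : ∀ i, i ≤ h - 4 → d i ≤ 2 * d (i + 1) + 1) : levelCost d t h ≤ 3.3715 := by
  obtain ⟨m, rfl⟩ := Nat.exists_eq_add_of_le' h3
  have e1 : m + 3 - 1 = m + 2 := rfl
  have e2 : m + 3 - 2 = m + 1 := rfl
  have e3 : m + 3 - 3 = m := rfl
  rw [e1] at hd1
  rw [e2] at hd2
  rw [e3] at hd3 ht3
  have t2 := ht (m + 2) (by omega)
  have t1 := ht (m + 1) (by omega)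
  rw [hd1, hth] at t2
  rw [hd2, t2] at t1
  have hbase : levelCost d t (m + 3) = levelCost d t m + 2.8 := by
    rw [levelCost_succ, levelCost_succ, levelCost_succ, hth, t2, t1, hd1, hd2, hd3]
    ring
  rcases m with _ | m
  · rw [hbase, levelCost]
    norm_num
  suffices H : ∀ i ≤ m,
      levelCost d t (m + 1) - levelCost d t i + 3 / (t (i + 1) : ℝ) ≤ 12 / 21 by
    have h0 := H 0 (by omega)
    have : 0 ≤ 3 / (t (0 + 1) : ℝ) := by positivity
    rw [hbase]
    rw [show levelCost d t 0 = 0 from Finset.sum_range_zero _] at h0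
    norm_num at *
    linarith
  intro i hi
  induction hi using Nat.decreasingInduction with
  | self =>
    have := hseq m (by omega)
    rw [hd3] at this
    have : (d m : ℝ) ≤ 9 := by exact_mod_cast this
    rw [levelCost_succ, ht3]
    push_cast
    linarith
  | of_succ i hi ih =>
    have hsucc := levelCost_succ (d := d) (t := t) i
    have hs : (d i : ℝ) ≤ 2 * d (i + 1) + 1 := by exact_mod_cast hseq i (by omega)
    have h4 : (4 : ℝ) ≤ d (i + 1) := by exact_mod_cast hd4 (i + 1) (by omega)
    have hT : (0 : ℝ) < t (i + 1 + 1) := by exact_mod_cast htpos _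
    have hti : (t (i + 1) : ℝ) = 1 + d (i + 1) * t (i + 1 + 1) := by
      exact_mod_cast ht (i + 1) (by omega)
    have hkey : (d i : ℝ) / t (i + 1) + 3 / t (i + 1) ≤ 3 / t (i + 1 + 1) := by
      rw [← add_div, hti, div_le_div_iff₀ (by positivity) hT]
      nlinarith
    linarith

end DegreeSequence

/-- Let `T` be a stable balanced tree with `n ≥ 3` agents, of height
`h`, with degree sequence `(0, 1, 2, 4, d_{h−4}, …, d_0)` where `d_i ≤ 2·d_{i+1} + 1`
for every `i ≤ h − 4`.  Then the Fairness Ratio satisfies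
`FR(T) ≤ 2.4318 · n · (ln ln(4√(n/5)))² / (ln(4√(n/5)))²`. -/
theorem fairness_ratio_balanced_trees {n : ℕ} (hn : 3 ≤ n) (h : ℕ) (d : ℕ → ℕ)
    (s : Fin (n + 1) → Fin (n + 1))
    (hstable : IsStable 0 s) (htree : ∀ v, ∃ k, s^[k] v = 0)
    (hheight : height s = h)
    (hbal : ∀ (v : Fin (n + 1)) (k : ℕ), s^[k] v = 0 → (∀ j < k, s^[j] v ≠ 0) →
      indeg 0 s v = d k)
    (hdh : d h = 0) (hd1 : d (h - 1) = 1) (hd2 : d (h - 2) = 2) (hd3 : d (h - 3) = 4)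
    (hseq : ∀ i, i ≤ h - 4 → d i ≤ 2 * d (i + 1) + 1) :
    FR s ≤ ENNReal.ofReal (2.4318 * (n : ℝ) *
        (Real.log (Real.log (4 * Real.sqrt ((n : ℝ) / 5)))) ^ 2 /
          (Real.log (4 * Real.sqrt ((n : ℝ) / 5))) ^ 2) := by
  have hs0 : s 0 = 0 := hstable.1.1
  have hdeg : ∀ v, (children s v).card = d (level s v) := fun v => by
    rw [← indeg_eq_card]
    exact hbal v _ (iterate_level htree v) fun j hj => iterate_ne_of_lt_level hj
  have hex : {k | ∀ v, s^[k] v = 0}.Nonempty := by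
    refine ⟨∑ v, level s v, fun v => ?_⟩
    have hle : level s v ≤ ∑ v, level s v :=
      Finset.single_le_sum (f := level s) (fun _ _ => Nat.zero_le _) (Finset.mem_univ v)
    rw [← Nat.sub_add_cancel hle, Function.iterate_add_apply, iterate_level htree,
      iterate_zero_root hs0]
  have hmem : ∀ v, s^[h] v = 0 := by
    rw [← hheight]
    exact Nat.sInf_mem hex
  have hlevel_le : ∀ v, level s v ≤ h := fun v => Nat.sInf_le (hmem v)
  have h3 : 3 ≤ h := by
    by_contra! hlt
    interval_cases h <;> simp_all
  obtain ⟨v₀, hv₀⟩ : ∃ v, level s v = h := by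
    by_contra! hne
    have hlt : ∀ v, level s v ≤ h - 1 := fun v => by
      have := hlevel_le v
      have := hne v
      omega
    have : h ≤ h - 1 := by
      nth_rewrite 1 [← hheight]
      refine Nat.sInf_le fun v => ?_
      rw [← Nat.sub_add_cancel (hlt v), Function.iterate_add_apply, iterate_level htree,
        iterate_zero_root hs0]
    omega
  have hexlevel : ∀ i ≤ h, ∃ v, level s v = i := fun i hi => by
    refine ⟨s^[h - i] v₀, ?_⟩
    have := level_iterate_add htree (v := v₀) (k := h - i) (by omega)
    omega
  obtain ⟨t, htpos, hth, ht⟩ : ∃ t : ℕ → ℕ, (∀ i, 0 < t i) ∧ t h = 1 ∧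
      ∀ i < h, t i = 1 + d i * t (i + 1) := by
    let τ : ℕ → ℕ := fun j => Nat.rec 1 (fun k x => 1 + d (h - (k + 1)) * x) j
    refine ⟨fun i => τ (h - i), fun i => ?_, ?_, fun i hi => ?_⟩
    · change 0 < τ (h - i)
      rcases h - i with _ | k
      · exact Nat.one_pos
      · exact Nat.lt_of_lt_of_le Nat.one_pos (Nat.le_add_right _ _)
    · change τ (h - h) = 1
      rw [Nat.sub_self]
      rfl
    · change τ (h - i) = 1 + d i * τ (h - (i + 1))
      obtain ⟨k, rfl⟩ := Nat.exists_eq_add_of_lt hi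
      rw [show i + k + 1 - i = k + 1 by omega, show i + k + 1 - (i + 1) = k by omega]
      change 1 + d (i + k + 1 - (k + 1)) * τ k = _
      rw [show i + k + 1 - (k + 1) = i by omega]
  have hsub : ∀ v, (subtree s v).card = t (level s v) := fun v =>
    card_subtree_of_level hs0 htree hdeg hdh hth ht (h - level s v) v
      (by have := hlevel_le v; omega)
  have hmono : ∀ i, i + 2 ≤ h → 2 ≤ d (i + 1) → d (i + 1) ≤ d i := fun i hi hd => by
    obtain ⟨v, hv⟩ := hexlevel (i + 2) hi
    exact degree_le_of_levelCost_le htpos hd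
      (hstable.levelCost_le_grandparent htree htpos hdeg hsub hv)
  have hd4 : ∀ i ≤ h - 3, 4 ≤ d i := fun i hi => four_le_degree hd3 hmono hi
  have ht2 : t (h - 2) = 5 := by
    rw [ht _ (by omega), hd2, show h - 2 + 1 = h - 1 by omega, ht _ (by omega), hd1,
      show h - 1 + 1 = h by omega, hth]
  have ht3 : t (h - 3) = 21 := by
    rw [ht _ (by omega), hd3, show h - 3 + 1 = h - 2 by omega, ht2]
  have hCh := levelCost_height_le h3 htpos ht hth hd1 hd2 hd3 ht3 hd4 hseq
  have hk4 := hd4 0 (by omega)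
  have hn1 : n = d 0 * t 1 := by
    have h0 := hsub 0
    have huniv : subtree s 0 = Finset.univ :=
      Finset.eq_univ_iff_forall.2 fun w => mem_subtree.2 (htree w)
    rw [huniv, Finset.card_univ, Fintype.card_fin, level_zero, ht 0 (by omega), zero_add] at h0
    omega
  have ht1 : 5 ≤ t 1 := by
    rcases h3.eq_or_lt with rfl | hlt
    · exact ht2.ge
    · rw [ht 1 (by omega)]
      have := Nat.mul_le_mul (hd4 1 (by omega)) (htpos (1 + 1))
      omega
  have hn20 : 20 ≤ n := by
    rw [hn1]
    exact Nat.mul_le_mul hk4 ht1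
  have hnk : n ≤ 12 * (d 0 * (d 0).factorial) := by
    have h1 : t 1 ≤ 12 * (d 0).factorial := by
      rcases h3.eq_or_lt with rfl | hlt
      · have h5 : t 1 = 5 := ht2
        have := Nat.factorial_pos (d 0)
        omega
      · have hfac := size_add_one_le_factorial htpos ht hd3 ht3 hmono (fun i hi hd => by
          obtain ⟨v, hv⟩ := hexlevel (i + 3) hi
          exact hstable.levelCost_le_uncle htree htpos hdeg hsub hv hd) (i := 0) (by omega)
        have := Nat.factorial_le
          (hmono 0 (by omega) (le_trans (by norm_num) (hd4 (0 + 1) (by omega))))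
        rw [zero_add] at *
        omega
    calc n = d 0 * t 1 := hn1
      _ ≤ d 0 * (12 * (d 0).factorial) := Nat.mul_le_mul_left _ h1
      _ = _ := by ring
  have hkpos : (0 : ℝ) < d 0 := by exact_mod_cast (by omega : 0 < d 0)
  have ht1pos : (0 : ℝ) < t 1 := by exact_mod_cast htpos 1
  have hC1 : levelCost d t 1 = d 0 / t 1 := by simp [levelCost]
  have hsup : (⨆ (v : Fin (n + 1)) (_ : v ≠ 0), cost 0 s v) ≤
      ENNReal.ofReal (levelCost d t h) :=
    iSup₂_le fun v _ => by
      rw [cost_eq_levelCost htree htpos hdeg hsub]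
      exact ENNReal.ofReal_le_ofReal (levelCost_mono (hlevel_le v))
  have hinf : ENNReal.ofReal (levelCost d t 1) ≤
      ⨅ (v : Fin (n + 1)) (_ : v ≠ 0), cost 0 s v :=
    le_iInf₂ fun v hv => by
      rw [cost_eq_levelCost htree htpos hdeg hsub]
      exact ENNReal.ofReal_le_ofReal (levelCost_mono (level_pos htree hv))
  calc FR s ≤ ENNReal.ofReal (levelCost d t h) / ENNReal.ofReal (levelCost d t 1) :=
        ENNReal.div_le_div hsup hinf
    _ = ENNReal.ofReal (levelCost d t h * n / (d 0 : ℝ) ^ 2) := by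
      rw [← ENNReal.ofReal_div_of_pos (by rw [hC1]; positivity), hC1]
      congr 1
      have hnr : (n : ℝ) = d 0 * t 1 := by exact_mod_cast hn1
      rw [hnr]
      field_simp
    _ ≤ _ := ENNReal.ofReal_le_ofReal (sq_log_le hk4 hn20 hnk hCh)

end TCG
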